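/- arXiv:1212.6100 — 2 statements merged into one kernel-verified Lean document; each statement's English description precedes it below -/
import Mathlib

section
/- Suppose that liminf_{|x|→∞} e^{V(x)} / |x|^{d+α} > 0. Then there exists a constant C₁ > 0 such that the weighted Poincaré inequality ∫ f(x)² · e^{V(x)} / (1 + |x|^{d+α}) μ_V(dx) ≤ C₁ · 𝓓_{α,V}(f,f) holds for every f ∈ C_b^∞(ℝ^d) with μ_V(f) = 0. In particular, there exists a constant C₂ > 0 such that μ_V(f²) ≤ C₂ · 𝓓_{α,V}(f,f) for every f ∈ C_b^∞(ℝ^d) with μ_V(f) = 0. -/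
open MeasureTheory Real Set Metric Filter

noncomputable section

/-- Euclidean space `ℝ^d`. -/
abbrev Ed (d : ℕ) := EuclideanSpace ℝ (Fin d)

/-- The probability measure `μ_V(dx) = C_V e^{-V(x)} dx` with `C_V = (∫ e^{-V})⁻¹`. -/
def muV (d : ℕ) (V : Ed d → ℝ) : Measure (Ed d) :=
  (volume : Measure (Ed d)).withDensity
    fun x => ENNReal.ofReal ((∫ y, Real.exp (-V y))⁻¹ * Real.exp (-V x))

/-- `f ∈ C_b^∞(ℝ^d)`: smooth with bounded derivatives of every order. -/
def CbSmooth (d : ℕ) (f : Ed d → ℝ) : Prop :=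
  ContDiff ℝ (⊤ : ℕ∞) f ∧ ∀ n : ℕ, ∃ C : ℝ, ∀ x, ‖iteratedFDeriv ℝ n f x‖ ≤ C

/-- `V` is locally bounded. -/
def LocallyBounded (d : ℕ) (V : Ed d → ℝ) : Prop :=
  ∀ r : ℝ, ∃ M : ℝ, ∀ x : Ed d, ‖x‖ ≤ r → |V x| ≤ M

/-- The nonlocal Dirichlet form with finite range jumps `𝓔_{α,V}`. -/
def formE (d : ℕ) (α : ℝ) (V f : Ed d → ℝ) : ℝ :=
  (1/2) * ∫ x, (∫ y in {y : Ed d | dist x y ≤ 1},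
      (f x - f y) ^ 2 / dist x y ^ ((d : ℝ) + α)) ∂(muV d V)

/-- The nonlocal Dirichlet form with large jumps `𝓓_{α,V}`. -/
def formD (d : ℕ) (α : ℝ) (V f : Ed d → ℝ) : ℝ :=
  (1/2) * ∫ x, (∫ y in {y : Ed d | 1 < dist x y},
      (f x - f y) ^ 2 / dist x y ^ ((d : ℝ) + α)) ∂(muV d V)

/-- `inf_{z : |x|-1 ≤ |z| ≤ |x|-1/2} e^{-V(z)}`. -/
def infAnn (d : ℕ) (V : Ed d → ℝ) (x : Ed d) : ℝ :=
  sInf ((fun z => Real.exp (-V z)) '' {z : Ed d | ‖x‖ - 1 ≤ ‖z‖ ∧ ‖z‖ ≤ ‖x‖ - 1/2})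

/-- `sup_{z : |x| ≤ |z| ≤ |x|+1} e^{-V(z)}`. -/
def supAnn (d : ℕ) (V : Ed d → ℝ) (x : Ed d) : ℝ :=
  sSup ((fun z => Real.exp (-V z)) '' {z : Ed d | ‖x‖ ≤ ‖z‖ ∧ ‖z‖ ≤ ‖x‖ + 1})

/-- `K(r) = sup_{|x| ≤ r} e^{-V(x)}`. -/
def Kfun (d : ℕ) (V : Ed d → ℝ) (r : ℝ) : ℝ :=
  sSup ((fun x => Real.exp (-V x)) '' {x : Ed d | ‖x‖ ≤ r})

/-- `k(r) = inf_{|x| ≤ r+1} e^{-V(x)}`. -/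
def kfun (d : ℕ) (V : Ed d → ℝ) (r : ℝ) : ℝ :=
  sInf ((fun x => Real.exp (-V x)) '' {x : Ed d | ‖x‖ ≤ r + 1})

/-- The constant `(1/α)·2^{2d+1}·(e + e^{1/2})·(2^α − 1)`. -/
def thresholdConst (d : ℕ) (α : ℝ) : ℝ :=
  (1/α) * (2:ℝ) ^ (2*d+1) * (Real.exp 1 + Real.exp (1/2)) * ((2:ℝ) ^ α - 1)

/-- The squared increment of `f` between two points, as an extended nonnegative real. -/
def sqIncr (d : ℕ) (f : Ed d → ℝ) (x y : Ed d) : ENNReal :=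
  ENNReal.ofReal ((f x - f y) ^ 2)

/-- The integral of `(f(x) - f(z))²` over the points `z` of the ball of radius `3` about the origin
that are at distance more than `1` from `x`. -/
def ballIncr (d : ℕ) (f : Ed d → ℝ) (x : Ed d) : ENNReal :=
  ∫⁻ z in ball 0 3 ∩ {z | 1 < dist x z}, sqIncr d f x z

/-- The weight `1 / (1 + |x|^p)`, as an extended nonnegative real. -/
def polyWeight (d : ℕ) (p : ℝ) (x : Ed d) : ENNReal :=
  ENNReal.ofReal (1 / (1 + ‖x‖ ^ p))

/-- The inner integral of the large-jump form, as an extended nonnegative real. -/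
def jumpEnergy (d : ℕ) (p : ℝ) (f : Ed d → ℝ) (x : Ed d) : ENNReal :=
  ∫⁻ y in {y : Ed d | 1 < dist x y}, ENNReal.ofReal ((f x - f y) ^ 2 / dist x y ^ p)

lemma measurable_sqIncr {d : ℕ} {f : Ed d → ℝ} (hf : Measurable f) :
    Measurable (Function.uncurry (sqIncr d f)) := by
  unfold sqIncr Function.uncurry
  fun_prop

lemma sqIncr_comm {d : ℕ} (f : Ed d → ℝ) (x y : Ed d) : sqIncr d f x y = sqIncr d f y x := by
  unfold sqIncr
  congr 1
  ring

lemma sqIncr_triangle {d : ℕ} (f : Ed d → ℝ) (x y z : Ed d) :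
    sqIncr d f x y ≤ 2 * sqIncr d f x z + 2 * sqIncr d f y z := by
  unfold sqIncr
  rw [show (2 : ENNReal) = ENNReal.ofReal 2 by simp, ← ENNReal.ofReal_mul (by norm_num),
    ← ENNReal.ofReal_mul (by norm_num), ← ENNReal.ofReal_add (by positivity) (by positivity)]
  apply ENNReal.ofReal_le_ofReal
  nlinarith [sq_nonneg ((f x - f z) + (f y - f z))]

lemma measurable_polyWeight (d : ℕ) (p : ℝ) : Measurable (polyWeight d p) := by
  unfold polyWeight
  fun_prop

lemma measurableSet_far {d : ℕ} (x : Ed d) : MeasurableSet {z : Ed d | 1 < dist x z} :=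
  measurableSet_lt measurable_const (by fun_prop)

lemma ballIncr_eq {d : ℕ} (f : Ed d → ℝ) (x : Ed d) :
    ballIncr d f x = ∫⁻ z in ball 0 3,
      {q : Ed d × Ed d | 1 < dist q.1 q.2}.indicator (Function.uncurry (sqIncr d f)) (x, z) := by
  unfold ballIncr
  rw [inter_comm, ← Measure.restrict_restrict (measurableSet_far x),
    ← lintegral_indicator (measurableSet_far x)]
  rfl

lemma measurable_indicator_far {d : ℕ} {g : Ed d × Ed d → ENNReal} (hg : Measurable g) :
    Measurable ({q : Ed d × Ed d | 1 < dist q.1 q.2}.indicator g) :=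
  hg.indicator (measurableSet_lt measurable_const (by fun_prop))

lemma measurable_ballIncr {d : ℕ} {f : Ed d → ℝ} (hf : Measurable f) :
    Measurable (ballIncr d f) := by
  rw [funext (ballIncr_eq f)]
  exact (measurable_indicator_far (measurable_sqIncr hf)).lintegral_prod_right'

lemma jumpEnergy_eq {d : ℕ} (p : ℝ) (f : Ed d → ℝ) (x : Ed d) :
    jumpEnergy d p f x = ∫⁻ y, {q : Ed d × Ed d | 1 < dist q.1 q.2}.indicator
      (fun q => ENNReal.ofReal ((f q.1 - f q.2) ^ 2 / dist q.1 q.2 ^ p)) (x, y) := by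
  unfold jumpEnergy
  rw [← lintegral_indicator (measurableSet_far x)]
  rfl

lemma measurable_jumpEnergy {d : ℕ} (p : ℝ) {f : Ed d → ℝ} (hf : Measurable f) :
    Measurable (jumpEnergy d p f) := by
  rw [funext (jumpEnergy_eq p f)]
  exact (measurable_indicator_far (by fun_prop)).lintegral_prod_right'

lemma volume_unitBall_le {d : ℕ} (hd : 1 ≤ d) (x y : Ed d) :
    volume (ball (0 : Ed d) 1) ≤
      volume (ball (0 : Ed d) 3 ∩ {z | 1 < dist x z} ∩ {z | 1 < dist y z}) := by
  set S := ball (0 : Ed d) 3 ∩ {z | 1 < dist x z} ∩ {z | 1 < dist y z}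
  set v := volume (ball (0 : Ed d) 1)
  have hfin : v ≠ ⊤ := measure_ball_lt_top.ne
  have hone (a : Ed d) : volume (closedBall a 1) = v := by
    rw [Measure.addHaar_closedBall _ _ zero_le_one]
    simp [v]
  have hsub : ball (0 : Ed d) 3 ⊆ S ∪ closedBall x 1 ∪ closedBall y 1 := by
    intro z hz
    by_cases h1 : 1 < dist x z
    · by_cases h2 : 1 < dist y z
      · exact Or.inl (Or.inl ⟨⟨hz, h1⟩, h2⟩)
      · exact Or.inr (by rw [mem_closedBall, dist_comm]; exact not_lt.mp h2)
    · exact Or.inl (Or.inr (by rw [mem_closedBall, dist_comm]; exact not_lt.mp h1))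
  have hthree : 3 * v ≤ volume (ball (0 : Ed d) 3) := by
    rw [Measure.addHaar_ball_of_pos _ _ (by norm_num : (0 : ℝ) < 3)]
    gcongr
    rw [show (3 : ENNReal) = ENNReal.ofReal 3 by simp]
    apply ENNReal.ofReal_le_ofReal
    rw [finrank_euclideanSpace_fin]
    exact le_self_pow₀ (by norm_num) (by omega)
  have hle : v + 2 * v ≤ volume S + 2 * v := by
    calc v + 2 * v = 3 * v := by ring
      _ ≤ volume (ball (0 : Ed d) 3) := hthree
      _ ≤ volume (S ∪ closedBall x 1 ∪ closedBall y 1) := measure_mono hsub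
      _ ≤ volume S + volume (closedBall x 1) + volume (closedBall y 1) :=
        (measure_union_le _ _).trans (by gcongr; exact measure_union_le _ _)
      _ = volume S + 2 * v := by rw [hone, hone]; ring
  exact (ENNReal.add_le_add_iff_right (ENNReal.mul_ne_top (by simp) hfin)).mp hle

lemma unitBall_mul_sqIncr_le {d : ℕ} (hd : 1 ≤ d) {f : Ed d → ℝ} (hf : Measurable f)
    (x y : Ed d) :
    volume (ball (0 : Ed d) 1) * sqIncr d f x y ≤ 2 * ballIncr d f x + 2 * ballIncr d f y := by
  set S := ball (0 : Ed d) 3 ∩ {z | 1 < dist x z} ∩ {z | 1 < dist y z} with hS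
  have hm (a : Ed d) : Measurable (sqIncr d f a) :=
    (measurable_sqIncr hf).comp measurable_prodMk_left
  calc volume (ball (0 : Ed d) 1) * sqIncr d f x y
      ≤ volume S * sqIncr d f x y := mul_le_mul_left (volume_unitBall_le hd x y) _
    _ = ∫⁻ _ in S, sqIncr d f x y := by rw [setLIntegral_const, mul_comm]
    _ ≤ ∫⁻ z in S, (2 * sqIncr d f x z + 2 * sqIncr d f y z) :=
        lintegral_mono fun z => sqIncr_triangle f x y z
    _ = 2 * (∫⁻ z in S, sqIncr d f x z) + 2 * ∫⁻ z in S, sqIncr d f y z := by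
        rw [lintegral_add_left ((hm x).const_mul 2), lintegral_const_mul _ (hm x),
          lintegral_const_mul _ (hm y)]
    _ ≤ 2 * ballIncr d f x + 2 * ballIncr d f y := by
        unfold ballIncr
        gcongr
        · exact inter_subset_left
        · exact fun z hz => ⟨hz.1.1, hz.2⟩

lemma isProbabilityMeasure_muV {d : ℕ} {V : Ed d → ℝ}
    (hVint : Integrable (fun x => Real.exp (-V x))) : IsProbabilityMeasure (muV d V) := by
  have hpos : 0 < ∫ y, Real.exp (-V y) := integral_exp_pos hVint
  constructor
  rw [muV, withDensity_apply _ MeasurableSet.univ, Measure.restrict_univ,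
    ← ofReal_integral_eq_lintegral_ofReal (hVint.const_mul _)
      (Eventually.of_forall fun x => by positivity),
    integral_const_mul, inv_mul_cancel₀ hpos.ne', ENNReal.ofReal_one]

lemma lintegral_muV {d : ℕ} {V : Ed d → ℝ} (hV : Measurable V) {g : Ed d → ENNReal}
    (hg : Measurable g) :
    ∫⁻ x, g x ∂(muV d V) =
      ∫⁻ x, ENNReal.ofReal ((∫ y, Real.exp (-V y))⁻¹ * Real.exp (-V x)) * g x := by
  rw [muV, lintegral_withDensity_eq_lintegral_mul _ (by fun_prop) hg]
  rfl

lemma ofReal_sq_le_lintegral_sqIncr {d : ℕ} {μ : Measure (Ed d)} [IsProbabilityMeasure μ]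
    {f : Ed d → ℝ} (hf : Measurable f) {M : ℝ} (hM : ∀ x, |f x| ≤ M)
    (hmean : ∫ x, f x ∂μ = 0) (x : Ed d) :
    ENNReal.ofReal ((f x) ^ 2) ≤ ∫⁻ y, sqIncr d f x y ∂μ := by
  have hint : Integrable f μ :=
    Integrable.of_bound hf.aestronglyMeasurable M (Eventually.of_forall hM)
  have hint2 : Integrable (fun y => (f y) ^ 2) μ :=
    Integrable.of_bound (hf.pow_const 2).aestronglyMeasurable (M ^ 2)
      (Eventually.of_forall fun y => by
        rw [norm_pow]
        exact pow_le_pow_left₀ (norm_nonneg _) (hM y) 2)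
  have hexp : (fun y => (f x - f y) ^ 2) = fun y => ((f x) ^ 2 - 2 * f x * f y) + (f y) ^ 2 := by
    ext y
    ring
  have hint3 : Integrable (fun y => (f x) ^ 2 - 2 * f x * f y) μ :=
    (integrable_const _).sub (hint.const_mul _)
  have hint4 : Integrable (fun y => (f x - f y) ^ 2) μ := by
    rw [hexp]
    exact hint3.add hint2
  unfold sqIncr
  rw [← ofReal_integral_eq_lintegral_ofReal hint4 (Eventually.of_forall fun y => sq_nonneg _)]
  apply ENNReal.ofReal_le_ofReal
  rw [hexp, integral_add hint3 hint2, integral_sub (integrable_const _) (hint.const_mul _),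
    integral_const_mul, hmean]
  have : 0 ≤ ∫ y, (f y) ^ 2 ∂μ := integral_nonneg fun y => sq_nonneg _
  simpa using this

lemma lintegral_one_add_norm_rpow_lt_top {d : ℕ} {p : ℝ} (hp : (d : ℝ) < p) :
    ∫⁻ x : Ed d, ENNReal.ofReal ((2 : ℝ) ^ p * (1 + ‖x‖) ^ (-p)) < ⊤ := by
  have h : Integrable (fun x : Ed d => (1 + ‖x‖) ^ (-p)) :=
    integrable_one_add_norm (by simpa using hp)
  exact (h.const_mul ((2 : ℝ) ^ p)).lintegral_lt_top

lemma one_add_rpow_le {p t : ℝ} (hp : 0 ≤ p) (ht : 0 ≤ t) :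
    (1 + t) ^ p ≤ (2 : ℝ) ^ p * (1 + t ^ p) := by
  have h0 : 0 ≤ t ^ p := by positivity
  rcases le_total t 1 with h | h
  · calc (1 + t) ^ p ≤ 2 ^ p := by gcongr; linarith
      _ ≤ 2 ^ p * (1 + t ^ p) := le_mul_of_one_le_right (by positivity) (by linarith)
  · calc (1 + t) ^ p ≤ (2 * t) ^ p := by gcongr; linarith
      _ = 2 ^ p * t ^ p := mul_rpow (by norm_num) ht
      _ ≤ 2 ^ p * (1 + t ^ p) := by gcongr; linarith

lemma lintegral_polyWeight_lt_top {d : ℕ} {p : ℝ} (hp : (d : ℝ) < p) :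
    ∫⁻ x, polyWeight d p x < ⊤ := by
  refine lt_of_le_of_lt (lintegral_mono fun x => ?_) (lintegral_one_add_norm_rpow_lt_top hp)
  apply ENNReal.ofReal_le_ofReal
  have hp0 : 0 ≤ p := (Nat.cast_nonneg d).trans hp.le
  rw [rpow_neg (by positivity), ← div_eq_mul_inv, div_le_div_iff₀ (by positivity) (by positivity),
    one_mul]
  exact one_add_rpow_le hp0 (norm_nonneg x)

/-- The jump energy of a bounded function is bounded. -/
lemma exists_jumpEnergy_le {d : ℕ} {p : ℝ} (hp : (d : ℝ) < p) {f : Ed d → ℝ} {M : ℝ}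
    (hM : ∀ x, |f x| ≤ M) : ∃ K : ENNReal, K ≠ ⊤ ∧ ∀ x, jumpEnergy d p f x ≤ K := by
  have hp0 : 0 ≤ p := (Nat.cast_nonneg d).trans hp.le
  refine ⟨ENNReal.ofReal ((2 * M) ^ 2) *
    ∫⁻ x : Ed d, ENNReal.ofReal ((2 : ℝ) ^ p * (1 + ‖x‖) ^ (-p)),
    ENNReal.mul_ne_top (by simp) (lintegral_one_add_norm_rpow_lt_top hp).ne, fun x => ?_⟩
  rw [← lintegral_sub_left_eq_self
      (fun z : Ed d => ENNReal.ofReal ((2 : ℝ) ^ p * (1 + ‖z‖) ^ (-p))) x,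
    ← lintegral_const_mul _ (by fun_prop)]
  refine (setLIntegral_mono (by fun_prop) fun y hy => ?_).trans (setLIntegral_le_lintegral _ _)
  rw [← ENNReal.ofReal_mul (by positivity)]
  apply ENNReal.ofReal_le_ofReal
  rw [← dist_eq_norm]
  have hy1 : 1 < dist x y := hy
  have hsq : (f x - f y) ^ 2 ≤ (2 * M) ^ 2 := by
    apply sq_le_sq'
    · linarith [abs_le.mp (hM x), abs_le.mp (hM y)]
    · linarith [abs_le.mp (hM x), abs_le.mp (hM y)]
  have hker : 1 / dist x y ^ p ≤ 2 ^ p * (1 + dist x y) ^ (-p) := by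
    rw [rpow_neg (by positivity), ← div_eq_mul_inv,
      div_le_div_iff₀ (by positivity) (by positivity), one_mul, ← mul_rpow (by norm_num) (by positivity)]
    gcongr
    linarith
  calc (f x - f y) ^ 2 / dist x y ^ p = (f x - f y) ^ 2 * (1 / dist x y ^ p) := by ring
    _ ≤ _ := by gcongr

lemma formD_eq {d : ℕ} {α : ℝ} (hα : 0 < α) {V : Ed d → ℝ} {f : Ed d → ℝ} (hf : Measurable f)
    {M : ℝ} (hM : ∀ x, |f x| ≤ M) :
    formD d α V f =
      (1 / 2) * (∫⁻ x, jumpEnergy d ((d : ℝ) + α) f x ∂(muV d V)).toReal := by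
  obtain ⟨K, hK, hle⟩ := exists_jumpEnergy_le (show (d : ℝ) < (d : ℝ) + α by linarith) hM
  rw [formD, ← integral_toReal (measurable_jumpEnergy _ hf).aemeasurable
    (Eventually.of_forall fun x => (hle x).trans_lt hK.lt_top)]
  congr 2
  ext x
  rw [integral_eq_lintegral_of_nonneg_ae (Eventually.of_forall fun y => by positivity)
    (Measurable.aestronglyMeasurable (by fun_prop))]
  rfl

lemma polyWeight_le {d : ℕ} {p : ℝ} (hp : 0 ≤ p) {x z : Ed d} (hz : z ∈ ball (0 : Ed d) 3)
    (hxz : 1 < dist z x) : 1 / (1 + ‖x‖ ^ p) ≤ 4 ^ p * (1 / dist z x ^ p) := by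
  have hz3 : ‖z‖ < 3 := by simpa using hz
  have hd : dist z x ≤ ‖z‖ + ‖x‖ := dist_le_norm_add_norm z x
  have h0 : 0 ≤ ‖x‖ ^ p := by positivity
  rw [mul_one_div, div_le_div_iff₀ (by positivity) (by positivity), one_mul]
  rcases le_total ‖x‖ 1 with h | h
  · calc dist z x ^ p ≤ 4 ^ p := by gcongr; linarith
      _ ≤ 4 ^ p * (1 + ‖x‖ ^ p) := le_mul_of_one_le_right (by positivity) (by linarith)
  · calc dist z x ^ p ≤ (4 * ‖x‖) ^ p := by gcongr; linarith
      _ = 4 ^ p * ‖x‖ ^ p := mul_rpow (by norm_num) (by positivity)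
      _ ≤ 4 ^ p * (1 + ‖x‖ ^ p) := by gcongr; linarith

/-- If the density of `μ_V` is at least `b⁻¹` on the ball of radius `3`, the weighted integral of
`ballIncr` is controlled by the large-jump form. -/
lemma lintegral_polyWeight_mul_ballIncr_le {d : ℕ} {p : ℝ} (hp : 0 ≤ p) {V : Ed d → ℝ}
    (hV : Measurable V) {b : ℝ} (hb0 : 0 ≤ b)
    (hb : ∀ z ∈ ball (0 : Ed d) 3, 1 ≤ b * ((∫ y, Real.exp (-V y))⁻¹ * Real.exp (-V z)))
    {f : Ed d → ℝ} (hf : Measurable f) :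
    ∫⁻ x, polyWeight d p x * ballIncr d f x ≤
      ENNReal.ofReal (b * 4 ^ p) * ∫⁻ z, jumpEnergy d p f z ∂(muV d V) := by
  set F : Ed d × Ed d → ENNReal :=
    {q : Ed d × Ed d | 1 < dist q.1 q.2}.indicator (Function.uncurry (sqIncr d f)) with hF
  have hFm : Measurable F := measurable_indicator_far (measurable_sqIncr hf)
  have hw := measurable_polyWeight d p
  calc ∫⁻ x, polyWeight d p x * ballIncr d f x
      = ∫⁻ x, ∫⁻ z in ball (0 : Ed d) 3, polyWeight d p x * F (x, z) := by
        congr 1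
        ext x
        rw [ballIncr_eq]
        exact (lintegral_const_mul _ (hFm.comp measurable_prodMk_left)).symm
    _ = ∫⁻ z in ball (0 : Ed d) 3, ∫⁻ x, polyWeight d p x * F (x, z) :=
        lintegral_lintegral_swap
          (((hw.comp measurable_fst).mul hFm).aemeasurable)
    _ ≤ ∫⁻ z in ball (0 : Ed d) 3, ENNReal.ofReal (b * 4 ^ p) *
          (ENNReal.ofReal ((∫ y, Real.exp (-V y))⁻¹ * Real.exp (-V z)) * jumpEnergy d p f z) := by
        refine setLIntegral_mono
          (((by fun_prop : Measurable fun z => ENNReal.ofReal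
            ((∫ y, Real.exp (-V y))⁻¹ * Real.exp (-V z))).mul
              (measurable_jumpEnergy p hf)).const_mul _) fun z hz => ?_
        rw [jumpEnergy_eq, ← mul_assoc, ← lintegral_const_mul]
        swap
        · exact (measurable_indicator_far (by fun_prop)).comp measurable_prodMk_left
        refine lintegral_mono fun x => ?_
        by_cases h : 1 < dist z x
        · rw [indicator_of_mem (show (z, x) ∈ {q : Ed d × Ed d | 1 < dist q.1 q.2} from h), hF,
            indicator_of_mem (show (x, z) ∈ {q : Ed d × Ed d | 1 < dist q.1 q.2} by
              simpa [dist_comm] using h)]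
          simp only [Function.uncurry, polyWeight, sqIncr]
          have he : 0 ≤ (∫ y, Real.exp (-V y))⁻¹ * Real.exp (-V z) := by
            by_contra! hneg
            nlinarith [hb z hz, mul_nonneg hb0 (neg_nonneg.mpr hneg.le)]
          rw [← ENNReal.ofReal_mul (by positivity), ← ENNReal.ofReal_mul (by positivity),
            ← ENNReal.ofReal_mul (mul_nonneg (by positivity) he)]
          apply ENNReal.ofReal_le_ofReal
          calc 1 / (1 + ‖x‖ ^ p) * (f x - f z) ^ 2
              ≤ (4 ^ p * (1 / dist z x ^ p)) * (f x - f z) ^ 2 := by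
                gcongr
                exact polyWeight_le hp hz h
            _ = 1 * (4 ^ p * ((f z - f x) ^ 2 / dist z x ^ p)) := by ring
            _ ≤ b * ((∫ y, Real.exp (-V y))⁻¹ * Real.exp (-V z)) *
                  (4 ^ p * ((f z - f x) ^ 2 / dist z x ^ p)) := by
                gcongr
                exact hb z hz
            _ = _ := by ring
        · rw [hF, indicator_of_notMem (by simpa [dist_comm] using h)]
          simp
    _ ≤ ∫⁻ z, ENNReal.ofReal (b * 4 ^ p) *
          (ENNReal.ofReal ((∫ y, Real.exp (-V y))⁻¹ * Real.exp (-V z)) * jumpEnergy d p f z) :=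
        setLIntegral_le_lintegral _ _
    _ = ENNReal.ofReal (b * 4 ^ p) * ∫⁻ z, jumpEnergy d p f z ∂(muV d V) := by
        rw [lintegral_const_mul' _ _ ENNReal.ofReal_ne_top,
          lintegral_muV hV (measurable_jumpEnergy p hf)]

/-- The weighted Poincaré inequality in terms of lower integrals. -/
lemma unitBall_mul_lintegral_le {d : ℕ} (hd : 1 ≤ d) {p : ℝ} (hp : 0 ≤ p) {V : Ed d → ℝ}
    (hV : Measurable V) (hVint : Integrable (fun x => Real.exp (-V x))) {b k : ℝ} (hb0 : 0 ≤ b)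
    (hk0 : 0 ≤ k)
    (hb : ∀ z ∈ ball (0 : Ed d) 3, 1 ≤ b * ((∫ y, Real.exp (-V y))⁻¹ * Real.exp (-V z)))
    (hk : ∀ x, (∫ y, Real.exp (-V y))⁻¹ * Real.exp (-V x) ≤ k * (1 / (1 + ‖x‖ ^ p)))
    {f : Ed d → ℝ} (hf : Measurable f) {M : ℝ} (hM : ∀ x, |f x| ≤ M)
    (hmean : ∫ x, f x ∂(muV d V) = 0) :
    volume (ball (0 : Ed d) 1) * ∫⁻ x, polyWeight d p x * ENNReal.ofReal ((f x) ^ 2) ≤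
      (2 + 2 * ENNReal.ofReal k * ∫⁻ x, polyWeight d p x) *
        (ENNReal.ofReal (b * 4 ^ p) * ∫⁻ z, jumpEnergy d p f z ∂(muV d V)) := by
  have := isProbabilityMeasure_muV hVint
  have hw := measurable_polyWeight d p
  have hG := measurable_ballIncr hf
  have hwG : Measurable fun x => polyWeight d p x * ballIncr d f x := hw.mul hG
  have hwf : Measurable fun x => polyWeight d p x * ENNReal.ofReal ((f x) ^ 2) :=
    hw.mul (by fun_prop)
  set v := volume (ball (0 : Ed d) 1)
  set A := ∫⁻ x, polyWeight d p x * ballIncr d f x with hA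
  have hGμ : ∫⁻ y, ballIncr d f y ∂(muV d V) ≤ ENNReal.ofReal k * A := by
    rw [lintegral_muV hV hG, hA, ← lintegral_const_mul _ hwG]
    refine lintegral_mono fun x => ?_
    rw [← mul_assoc, polyWeight, ← ENNReal.ofReal_mul hk0]
    exact mul_le_mul_left (ENNReal.ofReal_le_ofReal (hk x)) _
  have hpt (x : Ed d) : v * ENNReal.ofReal ((f x) ^ 2) ≤
      2 * ballIncr d f x + 2 * (ENNReal.ofReal k * A) := by
    calc v * ENNReal.ofReal ((f x) ^ 2)
        ≤ v * ∫⁻ y, sqIncr d f x y ∂(muV d V) := by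
          gcongr
          exact ofReal_sq_le_lintegral_sqIncr hf hM hmean x
      _ = ∫⁻ y, v * sqIncr d f x y ∂(muV d V) :=
          (lintegral_const_mul _ ((measurable_sqIncr hf).comp measurable_prodMk_left)).symm
      _ ≤ ∫⁻ y, (2 * ballIncr d f x + 2 * ballIncr d f y) ∂(muV d V) :=
          lintegral_mono fun y => unitBall_mul_sqIncr_le hd hf x y
      _ = 2 * ballIncr d f x + 2 * ∫⁻ y, ballIncr d f y ∂(muV d V) := by
          rw [lintegral_add_left measurable_const, lintegral_const, measure_univ, mul_one,
            lintegral_const_mul _ hG]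
      _ ≤ _ := by gcongr
  calc v * ∫⁻ x, polyWeight d p x * ENNReal.ofReal ((f x) ^ 2)
      = ∫⁻ x, polyWeight d p x * (v * ENNReal.ofReal ((f x) ^ 2)) := by
        rw [← lintegral_const_mul _ hwf]
        congr 1
        ext x
        ring
    _ ≤ ∫⁻ x, (2 * (polyWeight d p x * ballIncr d f x) +
          2 * (ENNReal.ofReal k * A) * polyWeight d p x) := by
        refine lintegral_mono fun x => ?_
        refine (mul_le_mul_right (hpt x) _).trans (le_of_eq ?_)
        ring
    _ = (2 + 2 * ENNReal.ofReal k * ∫⁻ x, polyWeight d p x) * A := by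
        rw [lintegral_add_left (hwG.const_mul 2), lintegral_const_mul _ hwG,
          lintegral_const_mul _ hw, ← hA]
        ring
    _ ≤ _ := by
        gcongr
        exact lintegral_polyWeight_mul_ballIncr_le hp hV hb0 hb hf

/-- A locally bounded potential growing like `p log |x|` has density bounded by a multiple of
`1 / (1 + |x|^p)`. -/
lemma exists_one_add_norm_rpow_le_exp {d : ℕ} {p : ℝ} (hp : 0 ≤ p) {V : Ed d → ℝ}
    (hVloc : LocallyBounded d V)
    (hliminf : ∃ c : ℝ, 0 < c ∧ ∃ R : ℝ, ∀ x : Ed d, R ≤ ‖x‖ →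
      c ≤ Real.exp (V x) / ‖x‖ ^ p) :
    ∃ k : ℝ, 0 < k ∧ ∀ x : Ed d, 1 + ‖x‖ ^ p ≤ k * Real.exp (V x) := by
  obtain ⟨c, hc, R, hR⟩ := hliminf
  obtain ⟨M, hM⟩ := hVloc (max R 1)
  refine ⟨max (2 / c) ((1 + (max R 1) ^ p) * Real.exp M), lt_max_of_lt_left (by positivity),
    fun x => ?_⟩
  rcases le_total ‖x‖ (max R 1) with h | h
  · calc 1 + ‖x‖ ^ p ≤ (1 + (max R 1) ^ p) * 1 := by rw [mul_one]; gcongr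
      _ ≤ (1 + (max R 1) ^ p) * (Real.exp M * Real.exp (V x)) := by
        gcongr
        rw [← Real.exp_add]
        exact Real.one_le_exp (by linarith [abs_le.mp (hM x h)])
      _ = ((1 + (max R 1) ^ p) * Real.exp M) * Real.exp (V x) := by ring
      _ ≤ _ := by gcongr; exact le_max_right _ _
  · have hx1 : 1 ≤ ‖x‖ := (le_max_right _ _).trans h
    have hxp : 1 ≤ ‖x‖ ^ p := Real.one_le_rpow hx1 hp
    have hcx := hR x ((le_max_left _ _).trans h)
    rw [le_div_iff₀ (by linarith)] at hcx
    calc 1 + ‖x‖ ^ p ≤ 2 / c * (c * ‖x‖ ^ p) := by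
          rw [← mul_assoc, div_mul_cancel₀ _ hc.ne']; linarith
      _ ≤ 2 / c * Real.exp (V x) := by gcongr
      _ ≤ _ := by gcongr; exact le_max_left _ _

/-- weighted Poincaré inequality and Poincaré inequality for the
large-jump Dirichlet form under `liminf_{|x|→∞} e^{V(x)}/|x|^{d+α} > 0`. -/
theorem weighted_poincare_large_jumps
    (d : ℕ) (hd : 1 ≤ d) (α : ℝ) (hα : 0 < α ∧ α < 2)
    (V : Ed d → ℝ) (hVmeas : Measurable V) (hVloc : LocallyBounded d V)
    (hVint : Integrable (fun x => Real.exp (-V x)))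
    (hliminf : ∃ c : ℝ, 0 < c ∧ ∃ R : ℝ, ∀ x : Ed d, R ≤ ‖x‖ →
      c ≤ Real.exp (V x) / ‖x‖ ^ ((d:ℝ) + α)) :
    (∃ C₁ : ℝ, 0 < C₁ ∧ ∀ f : Ed d → ℝ, CbSmooth d f →
      (∫ x, f x ∂(muV d V)) = 0 →
      ∫ x, (f x) ^ 2 * (Real.exp (V x) / (1 + ‖x‖ ^ ((d:ℝ) + α))) ∂(muV d V) ≤
        C₁ * formD d α V f) ∧
    (∃ C₂ : ℝ, 0 < C₂ ∧ ∀ f : Ed d → ℝ, CbSmooth d f →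
      (∫ x, f x ∂(muV d V)) = 0 →
      ∫ x, (f x) ^ 2 ∂(muV d V) ≤ C₂ * formD d α V f) := by
  obtain ⟨hα0, -⟩ := hα
  set p : ℝ := (d : ℝ) + α with hpdef
  have hdp : (d : ℝ) < p := by linarith
  have hp : 0 ≤ p := (Nat.cast_nonneg d).trans hdp.le
  set Z : ℝ := ∫ y, Real.exp (-V y) with hZ
  have hZpos : 0 < Z := integral_exp_pos hVint
  have hprob := isProbabilityMeasure_muV hVint
  obtain ⟨k, hk0, hk⟩ := exists_one_add_norm_rpow_le_exp hp hVloc hliminf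
  obtain ⟨M₀, hM₀⟩ := hVloc 3
  have hb : ∀ z ∈ ball (0 : Ed d) 3, 1 ≤ Z * Real.exp M₀ * (Z⁻¹ * Real.exp (-V z)) := by
    intro z hz
    have hz3 : ‖z‖ ≤ 3 := by simpa using (mem_ball.mp hz).le
    calc (1 : ℝ) ≤ Real.exp (M₀ + -V z) :=
          Real.one_le_exp (by linarith [abs_le.mp (hM₀ z hz3)])
      _ = _ := by rw [Real.exp_add]; field_simp
  have hk' : ∀ x : Ed d, Z⁻¹ * Real.exp (-V x) ≤ (Z⁻¹ * k) * (1 / (1 + ‖x‖ ^ p)) := by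
    intro x
    rw [mul_assoc]
    gcongr
    rw [mul_one_div, le_div_iff₀ (by positivity), Real.exp_neg,
      inv_mul_le_iff₀ (Real.exp_pos _), mul_comm]
    exact hk x
  set v := volume (ball (0 : Ed d) 1) with hv
  have hv0 : v ≠ 0 := (measure_ball_pos _ _ one_pos).ne'
  have hvtop : v ≠ ⊤ := measure_ball_lt_top.ne
  set L : ENNReal := (2 + 2 * ENNReal.ofReal (Z⁻¹ * k) * ∫⁻ x, polyWeight d p x) *
    ENNReal.ofReal (Z * Real.exp M₀ * 4 ^ p) with hL
  have hLtop : L ≠ ⊤ := by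
    have := (lintegral_polyWeight_lt_top hdp).ne
    finiteness
  have weighted : ∃ C₁ : ℝ, 0 < C₁ ∧ ∀ f : Ed d → ℝ, CbSmooth d f →
      (∫ x, f x ∂(muV d V)) = 0 →
      ∫ x, (f x) ^ 2 * (Real.exp (V x) / (1 + ‖x‖ ^ p)) ∂(muV d V) ≤ C₁ * formD d α V f := by
    refine ⟨2 * (Z⁻¹ * (v⁻¹ * L).toReal) + 1, by positivity, fun f hf hmean => ?_⟩
    have hfm : Measurable f := hf.1.continuous.measurable
    obtain ⟨M, hM⟩ := hf.2 0
    have hM' : ∀ x, |f x| ≤ M := fun x => by simpa using hM x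
    obtain ⟨K, hK, hle⟩ := exists_jumpEnergy_le hdp hM'
    set D := ∫⁻ x, jumpEnergy d p f x ∂(muV d V) with hD
    have hDtop : D ≠ ⊤ := by
      refine ne_top_of_le_ne_top hK ((lintegral_mono hle).trans ?_)
      simp
    have key := unitBall_mul_lintegral_le hd hp hVmeas hVint (by positivity) (by positivity)
      hb hk' hfm hM' hmean
    rw [← mul_assoc, ← hL, ← hD, ← hv] at key
    have key' : ∫⁻ x, polyWeight d p x * ENNReal.ofReal ((f x) ^ 2) ≤ v⁻¹ * L * D := by
      rw [mul_assoc, ← ENNReal.mul_le_iff_le_inv hv0 hvtop]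
      exact key
    have hlhs : ∫ x, (f x) ^ 2 * (Real.exp (V x) / (1 + ‖x‖ ^ p)) ∂(muV d V) =
        (ENNReal.ofReal Z⁻¹ *
          ∫⁻ x, polyWeight d p x * ENNReal.ofReal ((f x) ^ 2)).toReal := by
      rw [integral_eq_lintegral_of_nonneg_ae (Eventually.of_forall fun x => by positivity)
        (Measurable.aestronglyMeasurable (by fun_prop)),
        lintegral_muV hVmeas (by fun_prop), ← hZ, ← lintegral_const_mul' _ _ ENNReal.ofReal_ne_top]
      congr 2
      ext x
      rw [polyWeight, ← ENNReal.ofReal_mul (by positivity), ← ENNReal.ofReal_mul (by positivity),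
        ← ENNReal.ofReal_mul (by positivity), Real.exp_neg]
      congr 1
      field_simp
    rw [hlhs, formD_eq hα0 hfm hM', ← hpdef, ← hD]
    have hvL : v⁻¹ * L ≠ ⊤ := ENNReal.mul_ne_top (ENNReal.inv_ne_top.mpr hv0) hLtop
    calc (ENNReal.ofReal Z⁻¹ *
          ∫⁻ x, polyWeight d p x * ENNReal.ofReal ((f x) ^ 2)).toReal
        ≤ (ENNReal.ofReal Z⁻¹ * (v⁻¹ * L * D)).toReal :=
          ENNReal.toReal_mono (by finiteness) (by gcongr)
      _ = Z⁻¹ * ((v⁻¹ * L).toReal * D.toReal) := by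
          rw [ENNReal.toReal_mul, ENNReal.toReal_mul (a := v⁻¹ * L),
            ENNReal.toReal_ofReal (by positivity)]
      _ ≤ _ := by nlinarith [ENNReal.toReal_nonneg (a := D)]
  refine ⟨weighted, ?_⟩
  obtain ⟨C₁, hC₁, hw⟩ := weighted
  refine ⟨k * C₁, by positivity, fun f hf hmean => ?_⟩
  have hfm : Measurable f := hf.1.continuous.measurable
  obtain ⟨M, hM⟩ := hf.2 0
  have hM' : ∀ x, |f x| ≤ M := fun x => by simpa using hM x
  have hint : Integrable (fun x => (f x) ^ 2 * (Real.exp (V x) / (1 + ‖x‖ ^ p))) (muV d V) := by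
    refine ⟨Measurable.aestronglyMeasurable (by fun_prop), ?_⟩
    rw [hasFiniteIntegral_iff_ofReal (Eventually.of_forall fun x => by positivity),
      lintegral_muV hVmeas (by fun_prop)]
    refine lt_of_le_of_lt ?_ (ENNReal.mul_lt_top (ENNReal.ofReal_lt_top (r := Z⁻¹ * M ^ 2))
      (lintegral_polyWeight_lt_top hdp))
    rw [← lintegral_const_mul' _ _ ENNReal.ofReal_ne_top]
    refine lintegral_mono fun x => ?_
    rw [polyWeight, ← ENNReal.ofReal_mul (by positivity), ← ENNReal.ofReal_mul (by positivity)]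
    apply ENNReal.ofReal_le_ofReal
    calc Z⁻¹ * Real.exp (-V x) * ((f x) ^ 2 * (Real.exp (V x) / (1 + ‖x‖ ^ p)))
        = Z⁻¹ * (f x) ^ 2 * (1 / (1 + ‖x‖ ^ p)) := by rw [Real.exp_neg]; field_simp
      _ ≤ Z⁻¹ * M ^ 2 * (1 / (1 + ‖x‖ ^ p)) := by
        gcongr Z⁻¹ * ?_ * _
        exact sq_le_sq' (abs_le.mp (hM' x)).1 (abs_le.mp (hM' x)).2
  rw [mul_assoc]
  refine le_trans ?_ (mul_le_mul_of_nonneg_left (hw f hf hmean) hk0.le)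
  rw [← integral_const_mul]
  refine integral_mono_of_nonneg (Eventually.of_forall fun x => sq_nonneg _) (hint.const_mul k)
    (Eventually.of_forall fun x => ?_)
  calc (f x) ^ 2 = (f x) ^ 2 * 1 := (mul_one _).symm
    _ ≤ (f x) ^ 2 * (k * Real.exp (V x) / (1 + ‖x‖ ^ p)) := by
      gcongr
      rw [one_le_div (by positivity)]
      exact hk x
    _ = k * ((f x) ^ 2 * (Real.exp (V x) / (1 + ‖x‖ ^ p))) := by ring
end
end

section
/- There exists a constant C₄ > 0 such that for every r > 3 and every f ∈ C_b^∞(ℝ^d), ∫_{B(0,r)} ( f(x) − (μ_V(B(0,r)))^{−1} ∫_{B(0,r)} f dμ_V )² μ_V(dx) ≤ (C₄ K(r) r^{2d+α} / k(r)) · ∬_{B(0,r+1)×B(0,r+1)} (f(x)−f(y))² |x−y|^{−(d+α)} 𝟙_{{|x−y| > 1}} dy μ_V(dx), and in particular the left-hand side is at most (C₄ K(r) r^{2d+α} / k(r)) · 𝓓_{α,V}(f,f). -/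
open MeasureTheory Real Set Metric Filter

noncomputable section

/-- If `(u x - u y)² ≤ k (H x + H y)` on `B`, the variance of `u` on `B` is controlled by
the integral of `H`. -/
theorem setIntegral_sub_average_sq_le {X : Type*} [MeasurableSpace X] {μ : Measure X} {B : Set X}
    (hB : MeasurableSet B) [IsFiniteMeasure (μ.restrict B)] {u H : X → ℝ} {k : ℝ}
    (hu : MemLp u 2 (μ.restrict B)) (hH : IntegrableOn H B μ)
    (huH : ∀ x ∈ B, ∀ y ∈ B, (u x - u y) ^ 2 ≤ k * (H x + H y)) :
    ∫ x in B, (u x - (μ B).toReal⁻¹ * ∫ y in B, u y ∂μ) ^ 2 ∂μ ≤ 2 * k * ∫ x in B, H x ∂μ := by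
  have hsq (c : ℝ) : IntegrableOn (fun x => (u x - c) ^ 2) B μ :=
    (hu.sub (memLp_const c)).integrable_sq
  have hu1 : IntegrableOn u B μ := hu.integrable (by norm_num)
  have hBfin : μ B ≠ ⊤ := by
    rw [← Measure.restrict_apply_self]
    exact measure_ne_top _ _
  rcases eq_or_ne (μ B) 0 with h0 | h0
  · simp [Measure.restrict_eq_zero.2 h0]
  have hm : 0 < (μ B).toReal := ENNReal.toReal_pos h0 hBfin
  have hmreal : μ.real B = (μ B).toReal := rfl
  set m := (μ B).toReal
  set a := m⁻¹ * ∫ y in B, u y ∂μ with ha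
  have hma : m * a = ∫ y in B, u y ∂μ := by
    rw [ha]
    field_simp
  have hmin (c : ℝ) : ∫ x in B, (u x - a) ^ 2 ∂μ ≤ ∫ x in B, (u x - c) ^ 2 ∂μ := by
    have key : ∫ x in B, (u x - c) ^ 2 ∂μ
        = ∫ x in B, (u x - a) ^ 2 ∂μ + m * (a - c) ^ 2 := by
      have hpt : ∀ x, (u x - c) ^ 2
          = (u x - a) ^ 2 + (2 * (a - c) * u x + ((a - c) ^ 2 - 2 * (a - c) * a)) := by
        intro x; ring
      have hi1 : IntegrableOn (fun x => 2 * (a - c) * u x) B μ := hu1.const_mul _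
      have hi2 : IntegrableOn (fun _ : X => (a - c) ^ 2 - 2 * (a - c) * a) B μ :=
        integrable_const _
      have hi12 : IntegrableOn
          (fun x => 2 * (a - c) * u x + ((a - c) ^ 2 - 2 * (a - c) * a)) B μ := hi1.add hi2
      simp_rw [hpt]
      rw [integral_add (hsq a) hi12, integral_add hi1 hi2, integral_const_mul,
        setIntegral_const, smul_eq_mul, ← hma, hmreal]
      ring
    rw [key]
    nlinarith [mul_nonneg hm.le (sq_nonneg (a - c))]
  have hy : ∀ y ∈ B, ∫ x in B, (u x - a) ^ 2 ∂μ ≤ k * ((∫ x in B, H x ∂μ) + m * H y) := by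
    intro y hyB
    have hHy : IntegrableOn (fun x => H x + H y) B μ := hH.add (integrable_const _)
    calc
      _ ≤ ∫ x in B, (u x - u y) ^ 2 ∂μ := hmin _
      _ ≤ ∫ x in B, k * (H x + H y) ∂μ :=
        setIntegral_mono_on (hsq _) (hHy.const_mul k) hB fun x hx => huH x hx y hyB
      _ = _ := by
        rw [integral_const_mul, integral_add hH (integrable_const _), setIntegral_const,
          smul_eq_mul, hmreal]
  have hHm : IntegrableOn (fun y => (∫ x in B, H x ∂μ) + m * H y) B μ :=
    (integrable_const _).add (hH.const_mul m)
  have hint := setIntegral_mono_on (integrable_const (∫ x in B, (u x - a) ^ 2 ∂μ))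
    (hHm.const_mul k) hB hy
  rw [integral_const_mul, integral_add (integrable_const _) (hH.const_mul m),
    integral_const_mul, setIntegral_const, setIntegral_const, smul_eq_mul, smul_eq_mul,
    hmreal] at hint
  refine le_of_mul_le_mul_left ?_ hm
  linarith

/-- The integrand of the large-jump form with exponent `s`. -/
def jumpKernel (d : ℕ) (s : ℝ) (f : Ed d → ℝ) (x y : Ed d) : ℝ :=
  if 1 < dist x y then (f x - f y) ^ 2 / dist x y ^ s else 0

section jumpKernel

variable {d : ℕ} {s : ℝ} {f : Ed d → ℝ}

theorem jumpKernel_nonneg (x y : Ed d) : 0 ≤ jumpKernel d s f x y := by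
  unfold jumpKernel
  split_ifs <;> positivity

theorem measurable_jumpKernel (hf : Measurable f) :
    Measurable (Function.uncurry (jumpKernel d s f)) := by
  unfold jumpKernel Function.uncurry
  refine Measurable.ite (measurableSet_lt measurable_const (by fun_prop)) ?_ measurable_const
  fun_prop

theorem jumpKernel_le (hs : 0 ≤ s) {M : ℝ} (hM : ∀ x, |f x| ≤ M) (x y : Ed d) :
    jumpKernel d s f x y ≤ 4 * M ^ 2 * 2 ^ s * (1 + ‖y - x‖) ^ (-s) := by
  unfold jumpKernel
  split_ifs with h
  · have hsq : (f x - f y) ^ 2 ≤ 4 * M ^ 2 := by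
      have h1 := abs_le.1 (hM x)
      have h2 := abs_le.1 (hM y)
      nlinarith
    rw [dist_comm, dist_eq_norm] at *
    have hn : (0 : ℝ) < 1 + ‖y - x‖ := by positivity
    have hpow : (1 + ‖y - x‖) ^ s ≤ 2 ^ s * ‖y - x‖ ^ s := by
      rw [← Real.mul_rpow (by norm_num) (norm_nonneg _)]
      exact Real.rpow_le_rpow hn.le (by linarith) hs
    have hp1 : 0 < (1 + ‖y - x‖) ^ s := Real.rpow_pos_of_pos hn s
    have hp2 : 0 < ‖y - x‖ ^ s := Real.rpow_pos_of_pos (by linarith) s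
    rw [Real.rpow_neg hn.le, ← div_eq_mul_inv, div_le_div_iff₀ hp2 hp1]
    calc
      _ ≤ 4 * M ^ 2 * (2 ^ s * ‖y - x‖ ^ s) := by gcongr
      _ = _ := by ring
  · positivity

theorem integrable_jumpKernel (hds : (d : ℝ) < s) (hf : Measurable f) {M : ℝ}
    (hM : ∀ x, |f x| ≤ M) (x : Ed d) : Integrable (jumpKernel d s f x) := by
  have hs : 0 ≤ s := (Nat.cast_nonneg d).trans hds.le
  have hi : Integrable (fun y : Ed d => (1 + ‖y‖) ^ (-s)) :=
    integrable_one_add_norm (by simpa using hds)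
  refine ((hi.comp_sub_right x).const_mul (4 * M ^ 2 * 2 ^ s)).mono'
    ((measurable_jumpKernel hf).comp measurable_prodMk_left).aestronglyMeasurable
    (Eventually.of_forall fun y => ?_)
  rw [Real.norm_of_nonneg (jumpKernel_nonneg x y)]
  exact jumpKernel_le hs hM x y

theorem integrable_setIntegral_jumpKernel (hds : (d : ℝ) < s) (hf : Measurable f) {M : ℝ}
    (hM : ∀ x, |f x| ≤ M) (μ : Measure (Ed d)) [IsFiniteMeasure μ] (S : Set (Ed d)) :
    Integrable (fun x => ∫ y in S, jumpKernel d s f x y) μ := by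
  have hs : 0 ≤ s := (Nat.cast_nonneg d).trans hds.le
  have hi : Integrable (fun y : Ed d => (1 + ‖y‖) ^ (-s)) :=
    integrable_one_add_norm (by simpa using hds)
  refine Integrable.of_bound (C := ∫ y : Ed d, 4 * M ^ 2 * 2 ^ s * (1 + ‖y‖) ^ (-s))
    (measurable_jumpKernel hf).stronglyMeasurable.integral_prod_right.aestronglyMeasurable
    (Eventually.of_forall fun x => ?_)
  rw [Real.norm_of_nonneg (integral_nonneg fun y => jumpKernel_nonneg x y)]
  calc
    _ ≤ ∫ y, jumpKernel d s f x y :=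
      setIntegral_le_integral (integrable_jumpKernel hds hf hM x)
        (Eventually.of_forall fun y => jumpKernel_nonneg x y)
    _ ≤ ∫ y, 4 * M ^ 2 * 2 ^ s * (1 + ‖y - x‖) ^ (-s) :=
      integral_mono (integrable_jumpKernel hds hf hM x)
        ((hi.comp_sub_right x).const_mul _) fun y => jumpKernel_le hs hM x y
    _ = _ := integral_sub_right_eq_self (fun y : Ed d => 4 * M ^ 2 * 2 ^ s * (1 + ‖y‖) ^ (-s)) x

theorem sq_sub_le_jumpKernel (hs : 0 ≤ s) {r : ℝ} {x y : Ed d} (hxy : 1 < dist x y)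
    (hr : dist x y ≤ r) : (f x - f y) ^ 2 ≤ r ^ s * jumpKernel d s f x y := by
  have hp : 0 < dist x y ^ s := Real.rpow_pos_of_pos (by linarith) s
  rw [jumpKernel, if_pos hxy, ← mul_div_assoc, le_div_iff₀ hp, mul_comm]
  gcongr

/-- Points of `ball 0 r` at distance more than `1` from two given points fill at least
the volume of a unit ball. -/
theorem volume_unitBall_le_diff (hd : 1 ≤ d) {r : ℝ} (hr : 3 < r) (x y : Ed d) :
    volume.real (ball (0 : Ed d) 1) ≤
      volume.real (ball (0 : Ed d) r \ (closedBall x 1 ∪ closedBall y 1)) := by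
  have hc (z : Ed d) : volume.real (closedBall z 1) = volume.real (ball (0 : Ed d) 1) := by
    simp [measureReal_def, Measure.addHaar_closedBall _ z zero_le_one]
  have hr' : volume.real (ball (0 : Ed d) r) = r ^ d * volume.real (ball (0 : Ed d) 1) := by
    have hr0 : 0 < r := by linarith
    simp [measureReal_def, Measure.addHaar_ball_of_pos _ (0 : Ed d) hr0, hr0.le]
  have hrd : 3 ≤ r ^ d := by
    calc
      (3 : ℝ) ≤ r ^ 1 := by linarith
      _ ≤ r ^ d := pow_le_pow_right₀ (by linarith) hd
  have hun := measureReal_union_le (μ := (volume : Measure (Ed d)))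
    (closedBall x 1) (closedBall y 1)
  have hdiff := le_measureReal_sdiff (μ := (volume : Measure (Ed d)))
    (s₁ := ball (0 : Ed d) r) (s₂ := closedBall x 1 ∪ closedBall y 1)
    (measure_union_ne_top measure_closedBall_lt_top.ne measure_closedBall_lt_top.ne)
  rw [hc, hc] at hun
  rw [hr'] at hdiff
  nlinarith [measureReal_nonneg (μ := (volume : Measure (Ed d))) (s := ball (0 : Ed d) 1)]

/-- Pointwise comparison obtained by averaging over an intermediate point far from `x` and `y`. -/
theorem sq_sub_le_setIntegral_jumpKernel (hd : 1 ≤ d) (hds : (d : ℝ) < s) (hf : Measurable f)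
    {M : ℝ} (hM : ∀ x, |f x| ≤ M) {r : ℝ} (hr : 3 < r) {x y : Ed d}
    (hx : x ∈ ball (0 : Ed d) r) (hy : y ∈ ball (0 : Ed d) r) :
    volume.real (ball (0 : Ed d) 1) * (f x - f y) ^ 2 ≤
      2 * (2 * r) ^ s * ((∫ z in ball (0 : Ed d) (r + 1), jumpKernel d s f x z) +
        ∫ z in ball (0 : Ed d) (r + 1), jumpKernel d s f y z) := by
  have hs : 0 ≤ s := (Nat.cast_nonneg d).trans hds.le
  set A := ball (0 : Ed d) r \ (closedBall x 1 ∪ closedBall y 1)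
  have hAm : MeasurableSet A :=
    measurableSet_ball.diff (measurableSet_closedBall.union measurableSet_closedBall)
  have hAB : A ⊆ ball (0 : Ed d) (r + 1) :=
    sdiff_subset.trans (ball_subset_ball (by linarith))
  have hAfin : volume A ≠ ⊤ := measure_ne_top_of_subset hAB measure_ball_lt_top.ne
  have hix := integrable_jumpKernel hds hf hM x
  have hiy := integrable_jumpKernel hds hf hM y
  have hdist {w z : Ed d} (hw : w ∈ ball (0 : Ed d) r) (hz : z ∈ ball (0 : Ed d) r) :
      dist w z ≤ 2 * r := by
    have := dist_triangle_right w z 0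
    rw [mem_ball] at hw hz
    linarith
  have hpt : ∀ z ∈ A, (f x - f y) ^ 2 ≤
      2 * (2 * r) ^ s * (jumpKernel d s f x z + jumpKernel d s f y z) := by
    rintro z ⟨hz, hn⟩
    simp only [mem_union, mem_closedBall, not_or, not_le, dist_comm z] at hn
    have h1 := sq_sub_le_jumpKernel (f := f) hs hn.1 (hdist hx hz)
    have h2 := sq_sub_le_jumpKernel (f := f) hs hn.2 (hdist hy hz)
    nlinarith [sq_nonneg (f x + f y - 2 * f z)]
  calc
    _ ≤ volume.real A * (f x - f y) ^ 2 :=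
      mul_le_mul_of_nonneg_right (volume_unitBall_le_diff hd hr x y) (sq_nonneg _)
    _ = ∫ _ in A, (f x - f y) ^ 2 := by rw [setIntegral_const, smul_eq_mul]
    _ ≤ ∫ z in A, 2 * (2 * r) ^ s * (jumpKernel d s f x z + jumpKernel d s f y z) :=
      setIntegral_mono_on (integrableOn_const hAfin)
        ((hix.add hiy).const_mul _).integrableOn hAm hpt
    _ = 2 * (2 * r) ^ s *
        ((∫ z in A, jumpKernel d s f x z) + ∫ z in A, jumpKernel d s f y z) := by
      rw [integral_const_mul, integral_add hix.integrableOn hiy.integrableOn]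
    _ ≤ _ := by
      have hmono (w : Ed d) (hw : Integrable (jumpKernel d s f w)) :=
        setIntegral_mono_set (hw.integrableOn (s := ball (0 : Ed d) (r + 1)))
          (Eventually.of_forall fun z => jumpKernel_nonneg w z) hAB.eventuallyLE
      have hp : 0 ≤ 2 * (2 * r) ^ s := by positivity
      exact mul_le_mul_of_nonneg_left (add_le_add (hmono x hix) (hmono y hiy)) hp

end jumpKernel

theorem isFiniteMeasure_muV {d : ℕ} {V : Ed d → ℝ}
    (hVint : Integrable (fun x => Real.exp (-V x))) : IsFiniteMeasure (muV d V) :=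
  isFiniteMeasure_withDensity_ofReal (hVint.const_mul _).2

theorem formD_eq_integral_jumpKernel (d : ℕ) (α : ℝ) (V f : Ed d → ℝ) :
    formD d α V f = (1/2) * ∫ x, (∫ y, jumpKernel d (d + α) f x y) ∂(muV d V) := by
  unfold formD
  congr 2 with x
  rw [← integral_indicator (measurableSet_lt measurable_const (by fun_prop))]
  rfl

theorem kfun_pos {d : ℕ} {V : Ed d → ℝ} (hV : LocallyBounded d V) {r : ℝ} (hr : 0 ≤ r) :
    0 < kfun d V r := by
  obtain ⟨M, hM⟩ := hV (r + 1)
  refine (Real.exp_pos (-M)).trans_le (le_csInf ⟨_, 0, by simp; linarith, rfl⟩ ?_)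
  rintro _ ⟨x, hx, rfl⟩
  exact Real.exp_le_exp.2 (neg_le_neg (abs_le.1 (hM x hx)).2)

theorem kfun_le_Kfun {d : ℕ} {V : Ed d → ℝ} (hV : LocallyBounded d V) {r : ℝ} (hr : 0 ≤ r) :
    kfun d V r ≤ Kfun d V r := by
  obtain ⟨M, hM⟩ := hV r
  have h1 : kfun d V r ≤ Real.exp (-V 0) :=
    csInf_le ⟨0, by rintro _ ⟨x, -, rfl⟩; exact (Real.exp_pos _).le⟩
      ⟨0, by simp; linarith, rfl⟩
  have h2 : Real.exp (-V 0) ≤ Kfun d V r := by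
    refine le_csSup ⟨Real.exp M, ?_⟩ ⟨0, by simpa using hr, rfl⟩
    rintro _ ⟨x, hx, rfl⟩
    exact Real.exp_le_exp.2 (by linarith [(abs_le.1 (hM x hx)).1])
  exact h1.trans h2

/-- local Poincaré inequality for `𝓓_{α,V}` on balls of radius `r > 3`. -/
theorem local_poincare_formD
    (d : ℕ) (hd : 1 ≤ d) (α : ℝ) (hα : 0 < α ∧ α < 2)
    (V : Ed d → ℝ) (hVmeas : Measurable V) (hVloc : LocallyBounded d V)
    (hVint : Integrable (fun x => Real.exp (-V x))) :
    ∃ C₄ : ℝ, 0 < C₄ ∧ ∀ r : ℝ, 3 < r → ∀ f : Ed d → ℝ, CbSmooth d f →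
      (∫ x in ball (0 : Ed d) r,
          (f x - (muV d V (ball (0 : Ed d) r)).toReal⁻¹ *
            ∫ y in ball (0 : Ed d) r, f y ∂(muV d V)) ^ 2 ∂(muV d V)) ≤
        C₄ * Kfun d V r * r ^ (2*(d:ℝ) + α) / kfun d V r *
          (∫ x in ball (0 : Ed d) (r+1), (∫ y in ball (0 : Ed d) (r+1),
              (if 1 < dist x y then (f x - f y) ^ 2 / dist x y ^ ((d:ℝ) + α) else 0))
            ∂(muV d V)) ∧
      (∫ x in ball (0 : Ed d) r,
          (f x - (muV d V (ball (0 : Ed d) r)).toReal⁻¹ *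
            ∫ y in ball (0 : Ed d) r, f y ∂(muV d V)) ^ 2 ∂(muV d V)) ≤
        C₄ * Kfun d V r * r ^ (2*(d:ℝ) + α) / kfun d V r * formD d α V f := by
  have hω : 0 < volume.real (ball (0 : Ed d) 1) :=
    ENNReal.toReal_pos (measure_ball_pos _ _ one_pos).ne' measure_ball_lt_top.ne
  set ω := volume.real (ball (0 : Ed d) 1)
  set s : ℝ := d + α
  have hds : (d : ℝ) < s := by linarith [hα.1]
  refine ⟨8 * 2 ^ s / ω, by positivity, fun r hr f hf => ?_⟩
  have hr0 : 0 ≤ r := by linarith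
  have := isFiniteMeasure_muV hVint
  have hfm : Measurable f := hf.1.continuous.measurable
  obtain ⟨M, hM⟩ := hf.2 0
  simp only [norm_iteratedFDeriv_zero, Real.norm_eq_abs] at hM
  set μ := muV d V
  set H : Ed d → ℝ := fun x => ∫ y in ball (0 : Ed d) (r + 1), jumpKernel d s f x y
  have hHint : Integrable H μ := integrable_setIntegral_jumpKernel hds hfm hM μ _
  have hH0 (x : Ed d) : 0 ≤ H x := integral_nonneg fun y => jumpKernel_nonneg x y
  have hvar := setIntegral_sub_average_sq_le (μ := μ) (u := f) (H := H)
    (k := 2 * (2 * r) ^ s / ω) (measurableSet_ball (x := (0 : Ed d)) (ε := r))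
    (MemLp.of_bound hfm.aestronglyMeasurable M (Eventually.of_forall hM)) hHint.integrableOn
    fun x hx y hy => by
      rw [div_mul_eq_mul_div, le_div_iff₀ hω, mul_comm]
      exact sq_sub_le_setIntegral_jumpKernel hd hds hfm hM hr hx hy
  have hJ : ∫ x in ball (0 : Ed d) r, H x ∂μ ≤ ∫ x in ball (0 : Ed d) (r + 1), H x ∂μ :=
    setIntegral_mono_set hHint.integrableOn (Eventually.of_forall hH0)
      (ball_subset_ball (by linarith)).eventuallyLE
  have hJ0 : 0 ≤ ∫ x in ball (0 : Ed d) (r + 1), H x ∂μ := integral_nonneg hH0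
  have hD : ∫ x in ball (0 : Ed d) (r + 1), H x ∂μ ≤ 2 * formD d α V f := by
    have hU : Integrable (fun x => ∫ y, jumpKernel d s f x y) μ := by
      simpa using integrable_setIntegral_jumpKernel hds hfm hM μ univ
    rw [formD_eq_integral_jumpKernel, ← mul_assoc, mul_one_div_cancel two_ne_zero, one_mul]
    refine (setIntegral_le_integral hHint (Eventually.of_forall hH0)).trans
      (integral_mono hHint hU fun x => ?_)
    exact setIntegral_le_integral (integrable_jumpKernel hds hfm hM x)
      (Eventually.of_forall fun y => jumpKernel_nonneg x y)
  have hconst : 2 * (2 * (2 * (2 * r) ^ s / ω)) ≤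
      8 * 2 ^ s / ω * Kfun d V r * r ^ (2*(d:ℝ) + α) / kfun d V r := by
    have hk := kfun_pos hVloc hr0
    have hpow : r ^ s ≤ r ^ (2*(d:ℝ) + α) :=
      Real.rpow_le_rpow_of_exponent_le (by linarith)
        (by linarith [(Nat.cast_nonneg d : (0:ℝ) ≤ d)])
    have hKk : 1 ≤ Kfun d V r / kfun d V r :=
      (one_le_div hk).2 (kfun_le_Kfun hVloc hr0)
    calc
      _ = 8 * 2 ^ s / ω * 1 * r ^ s := by
        rw [Real.mul_rpow (by norm_num) hr0]
        ring
      _ ≤ 8 * 2 ^ s / ω * (Kfun d V r / kfun d V r) * r ^ (2*(d:ℝ) + α) := by gcongr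
      _ = _ := by ring
  set c := 2 * (2 * (2 * r) ^ s / ω)
  have hc : 0 ≤ c := by positivity
  have hD0 : 0 ≤ formD d α V f := by linarith
  refine ⟨hvar.trans ?_, hvar.trans ?_⟩
  · exact (mul_le_mul_of_nonneg_left hJ hc).trans
      (mul_le_mul_of_nonneg_right (by linarith) hJ0)
  · calc
      _ ≤ c * (2 * formD d α V f) := mul_le_mul_of_nonneg_left (hJ.trans hD) hc
      _ = 2 * c * formD d α V f := by ring
      _ ≤ _ := mul_le_mul_of_nonneg_right hconst hD0
end
end
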